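/- Let Λ be the quotient of the free K-algebra on generators c, c*, z, w by the two-sided ideal generated by z w − 1, w z − 1, z − 1 − c* c, and z − 1 − c c*. Then Λ is a commutative K-algebra, and it is isomorphic as a K-algebra to K[x, y, (1+xy)^{−1}], the localization of the polynomial ring K[x, y] away from the element 1 + x y, via c ↦ x and c* ↦ y. -/

import Mathlib

namespace SelfPlumbing

/-- Generators `c, c*, z, w` (`w = z⁻¹`). -/
inductive PGen : Type
  | c
  | cst
  | z
  | w

open PGen

variable (K : Type) [Field K]

/-- The relations `z w = w z = 1`, `z = 1 + c* c` and `z = 1 + c c*`. -/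
inductive Rel : FreeAlgebra K PGen → FreeAlgebra K PGen → Prop
  | zw : Rel (FreeAlgebra.ι K z * FreeAlgebra.ι K w) 1
  | wz : Rel (FreeAlgebra.ι K w * FreeAlgebra.ι K z) 1
  | rel1 : Rel (FreeAlgebra.ι K z - 1 - FreeAlgebra.ι K cst * FreeAlgebra.ι K c) 0
  | rel2 : Rel (FreeAlgebra.ι K z - 1 - FreeAlgebra.ι K c * FreeAlgebra.ι K cst) 0

/-- The multiplicative preprojective algebra `Λ` of the one-vertex, one-loop graph,
specialized at `t = 1`. -/
abbrev Lambda := RingQuot (Rel K)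

def ι (x : PGen) : Lambda K := RingQuot.mkAlgHom K (Rel K) (FreeAlgebra.ι K x)

/-- The localization `K[x, y, (1+xy)⁻¹]` of the polynomial ring in two variables away
from `1 + xy`. -/
abbrev Loc := Localization.Away
  ((1 : MvPolynomial (Fin 2) K) + MvPolynomial.X 0 * MvPolynomial.X 1)

end SelfPlumbing

open SelfPlumbing SelfPlumbing.PGen

namespace SelfPlumbing

section Commutativity

variable (K : Type) [Field K]

lemma z_mul_w : ι K z * ι K w = 1 := by
  simpa [ι] using RingQuot.mkAlgHom_rel K (Rel.zw (K := K))

lemma w_mul_z : ι K w * ι K z = 1 := by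
  simpa [ι] using RingQuot.mkAlgHom_rel K (Rel.wz (K := K))

lemma z_eq_one_add_cst_mul_c : ι K z = 1 + ι K cst * ι K c := by
  have h := RingQuot.mkAlgHom_rel K (Rel.rel1 (K := K))
  simp only [map_sub, map_mul, map_one, map_zero] at h
  exact (sub_eq_iff_eq_add'.mp (sub_eq_zero.mp h))

lemma z_eq_one_add_c_mul_cst : ι K z = 1 + ι K c * ι K cst := by
  have h := RingQuot.mkAlgHom_rel K (Rel.rel2 (K := K))
  simp only [map_sub, map_mul, map_one, map_zero] at h
  exact (sub_eq_iff_eq_add'.mp (sub_eq_zero.mp h))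

lemma commute_c_cst : Commute (ι K c) (ι K cst) :=
  add_left_cancel ((z_eq_one_add_c_mul_cst K).symm.trans (z_eq_one_add_cst_mul_c K))

variable {K}

lemma commute_z {a : Lambda K} (hc : Commute (ι K c) a) (hcst : Commute (ι K cst) a) :
    Commute (ι K z) a := by
  rw [z_eq_one_add_c_mul_cst]
  exact (Commute.one_left a).add_left (hc.mul_left hcst)

lemma commute_w {a : Lambda K} (hz : Commute (ι K z) a) : Commute (ι K w) a :=
  let u : (Lambda K)ˣ := ⟨ι K z, ι K w, z_mul_w K, w_mul_z K⟩
  Commute.units_inv_left (u := u) hz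

/-- An element commuting with `c` and `c*` is central. -/
lemma commute_of_commute_c_cst {a : Lambda K} (hc : Commute (ι K c) a)
    (hcst : Commute (ι K cst) a) (x : Lambda K) : Commute x a := by
  obtain ⟨p, rfl⟩ := RingQuot.mkAlgHom_surjective K (Rel K) x
  induction p using FreeAlgebra.induction with
  | grade0 r => rw [AlgHom.commutes]; exact Algebra.commutes r a
  | grade1 g =>
    cases g with
    | c => exact hc
    | cst => exact hcst
    | z => exact commute_z hc hcst
    | w => exact commute_w (commute_z hc hcst)
  | mul p q hp hq => rw [map_mul]; exact hp.mul_left hq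
  | add p q hp hq => rw [map_add]; exact hp.add_left hq

lemma commute_all (x y : Lambda K) : Commute x y :=
  commute_of_commute_c_cst
    (commute_of_commute_c_cst (Commute.refl _) (commute_c_cst K).symm y).symm
    (commute_of_commute_c_cst (commute_c_cst K) (Commute.refl _) y).symm x

noncomputable instance : CommRing (Lambda K) where
  mul_comm := commute_all

end Commutativity

section Isomorphism

variable (K : Type) [Field K]

/-- Two algebra maps out of `Λ` agree as soon as they agree on `c` and `c*`. -/
lemma lambda_algHom_ext {B : Type*} [Ring B] [Algebra K B] {f g : Lambda K →ₐ[K] B}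
    (hc : f (ι K c) = g (ι K c)) (hcst : f (ι K cst) = g (ι K cst)) : f = g := by
  have hz : f (ι K z) = g (ι K z) := by
    simp only [z_eq_one_add_c_mul_cst, map_add, map_one, map_mul, hc, hcst]
  have hw : f (ι K w) = g (ι K w) := by
    refine left_inv_eq_right_inv (a := f (ι K z)) ?_ ?_
    · rw [← map_mul, w_mul_z, map_one]
    · rw [hz, ← map_mul, z_mul_w, map_one]
  apply RingQuot.ringQuot_ext'
  apply FreeAlgebra.hom_ext
  funext g
  cases g with
  | c => exact hc
  | cst => exact hcst
  | z => exact hz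
  | w => exact hw

/-- The images of the generators of `Λ` in `K[x, y, (1+xy)⁻¹]`. -/
noncomputable def genToLoc : PGen → Loc K
  | c => algebraMap (MvPolynomial (Fin 2) K) (Loc K) (MvPolynomial.X 0)
  | cst => algebraMap (MvPolynomial (Fin 2) K) (Loc K) (MvPolynomial.X 1)
  | z => algebraMap (MvPolynomial (Fin 2) K) (Loc K)
      (1 + MvPolynomial.X 0 * MvPolynomial.X 1)
  | w => IsLocalization.Away.invSelf
      ((1 : MvPolynomial (Fin 2) K) + MvPolynomial.X 0 * MvPolynomial.X 1)

lemma genToLoc_z_mul_w : genToLoc K z * genToLoc K w = 1 :=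
  IsLocalization.Away.mul_invSelf _

lemma genToLoc_z : genToLoc K z = 1 + genToLoc K c * genToLoc K cst := by
  simp only [genToLoc, map_add, map_one, map_mul]

/-- The map `Λ → K[x, y, (1+xy)⁻¹]` with `c ↦ x` and `c* ↦ y`. -/
noncomputable def toLoc : Lambda K →ₐ[K] Loc K :=
  RingQuot.liftAlgHom K ⟨FreeAlgebra.lift K (genToLoc K), by
    intro p q h
    cases h with
    | zw => simp [genToLoc_z_mul_w]
    | wz => simp [mul_comm (genToLoc K w), genToLoc_z_mul_w]
    | rel1 => simp [genToLoc_z, mul_comm (genToLoc K cst)]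
    | rel2 => simp [genToLoc_z]⟩

lemma toLoc_ι (g : PGen) : toLoc K (ι K g) = genToLoc K g := by
  simp [toLoc, ι]

/-- The map `K[x, y] → Λ` with `x ↦ c` and `y ↦ c*`. -/
noncomputable def ofPoly : MvPolynomial (Fin 2) K →ₐ[K] Lambda K :=
  MvPolynomial.aeval ![ι K c, ι K cst]

lemma ofPoly_X_zero : ofPoly K (MvPolynomial.X 0) = ι K c := by
  simp [ofPoly]

lemma ofPoly_X_one : ofPoly K (MvPolynomial.X 1) = ι K cst := by
  simp [ofPoly]

lemma isUnit_ofPoly :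
    IsUnit (ofPoly K (1 + MvPolynomial.X 0 * MvPolynomial.X 1)) := by
  rw [map_add, map_one, map_mul, ofPoly_X_zero, ofPoly_X_one, ← z_eq_one_add_c_mul_cst]
  exact IsUnit.of_mul_eq_one _ (z_mul_w K)

/-- The map `K[x, y, (1+xy)⁻¹] → Λ` with `x ↦ c` and `y ↦ c*`. -/
noncomputable def ofLoc : Loc K →ₐ[K] Lambda K :=
  IsLocalization.liftAlgHom
    (M := Submonoid.powers ((1 : MvPolynomial (Fin 2) K) + MvPolynomial.X 0 * MvPolynomial.X 1))
    (f := ofPoly K) (by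
      rintro ⟨_, n, rfl⟩
      simpa only [map_pow] using (isUnit_ofPoly K).pow n)

lemma ofLoc_algebraMap (p : MvPolynomial (Fin 2) K) :
    ofLoc K (algebraMap (MvPolynomial (Fin 2) K) (Loc K) p) = ofPoly K p := by
  simp [ofLoc]

lemma ofLoc_comp_toLoc : (ofLoc K).comp (toLoc K) = AlgHom.id K (Lambda K) := by
  apply lambda_algHom_ext
  · simp [toLoc_ι, genToLoc, ofLoc_algebraMap, ofPoly_X_zero]
  · simp [toLoc_ι, genToLoc, ofLoc_algebraMap, ofPoly_X_one]

lemma toLoc_comp_ofLoc : (toLoc K).comp (ofLoc K) = AlgHom.id K (Loc K) := by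
  apply IsLocalization.algHom_ext
    (Submonoid.powers ((1 : MvPolynomial (Fin 2) K) + MvPolynomial.X 0 * MvPolynomial.X 1))
  apply MvPolynomial.algHom_ext
  intro i
  fin_cases i
  · change toLoc K (ofLoc K (algebraMap _ _ (MvPolynomial.X 0))) =
      algebraMap _ _ (MvPolynomial.X 0)
    rw [ofLoc_algebraMap, ofPoly_X_zero, toLoc_ι, genToLoc]
  · change toLoc K (ofLoc K (algebraMap _ _ (MvPolynomial.X 1))) =
      algebraMap _ _ (MvPolynomial.X 1)
    rw [ofLoc_algebraMap, ofPoly_X_one, toLoc_ι, genToLoc]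

/-- The isomorphism `Λ ≃ K[x, y, (1+xy)⁻¹]` with `c ↦ x` and `c* ↦ y`. -/
noncomputable def lambdaEquivLoc : Lambda K ≃ₐ[K] Loc K :=
  AlgEquiv.ofAlgHom (toLoc K) (ofLoc K) (toLoc_comp_ofLoc K) (ofLoc_comp_toLoc K)

end Isomorphism

end SelfPlumbing

/-- The quotient `Λ` of the free `K`-algebra on `c, c*, z, w` by
`zw = wz = 1`, `z = 1 + c*c` and `z = 1 + cc*` is a commutative `K`-algebra, isomorphic
to `K[x, y, (1+xy)⁻¹]` via `c ↦ x`, `c* ↦ y`. -/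
theorem statement14 (K : Type) [Field K] :
    (∀ x y : Lambda K, x * y = y * x) ∧
    ∃ Φ : Lambda K ≃ₐ[K] Loc K,
      Φ (ι K c) = algebraMap (MvPolynomial (Fin 2) K) (Loc K) (MvPolynomial.X 0) ∧
      Φ (ι K cst) = algebraMap (MvPolynomial (Fin 2) K) (Loc K) (MvPolynomial.X 1) := by
  exact ⟨commute_all, lambdaEquivLoc K, toLoc_ι K c, toLoc_ι K cst⟩
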